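/- Let G be a finite simple graph on [r] = {1,…,r} with no isolated vertices. Then for every a ∈ ℕ^r, the complex Δ_a(I_G) has no isolated vertices: for every p ∈ [r], it is impossible that simultaneously x^a ∉ I_G[{p}]S and x^a ∈ I_G[{p,j}]S for every j ≠ p. -/

import Mathlib

open MvPolynomial

/-- The Stanley–Reisner ideal of a graph viewed as a one-dimensional simplicial complex. -/
noncomputable def SRIdeal (K : Type*) [Field K] {r : ℕ} (G : SimpleGraph (Fin r)) :
    Ideal (MvPolynomial (Fin r) K) :=
  Ideal.span
    ({p | ∃ i j : Fin r, i ≠ j ∧ ¬ G.Adj i j ∧ p = X i * X j} ∪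
     {p | ∃ i j k : Fin r, i ≠ j ∧ i ≠ k ∧ j ≠ k ∧ p = X i * X j * X k})

/-- Monomial localization `I_G[F]S`. -/
noncomputable def locSR (K : Type*) [Field K] {r : ℕ} (G : SimpleGraph (Fin r))
    (F : Finset (Fin r)) : Ideal (MvPolynomial (Fin r) K) :=
  Ideal.map (aeval (fun i : Fin r => if i ∈ F then 1 else X i) :
      MvPolynomial (Fin r) K →ₐ[K] MvPolynomial (Fin r) K) (SRIdeal K G)

/-- If `p` and `j` are adjacent, a monomial supported on `{p, j}` lies outside `I_G[{p, j}]S`. -/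
lemma prod_X_pow_notMem_locSR_pair (K : Type*) [Field K] {r : ℕ} (G : SimpleGraph (Fin r))
    {p j : Fin r} (hpj : G.Adj p j) (a : Fin r → ℕ)
    (ha : ∀ i, i ≠ p → i ≠ j → a i = 0) :
    (∏ i, (X i : MvPolynomial (Fin r) K) ^ a i) ∉ locSR K G {p, j} := by
  intro hmem
  let φ : MvPolynomial (Fin r) K →ₐ[K] K :=
    aeval (fun i : Fin r => if i = p ∨ i = j then (1 : K) else 0)
  have hle : locSR K G {p, j} ≤ RingHom.ker φ := by
    unfold locSR SRIdeal
    rw [Ideal.map_le_iff_le_comap, Ideal.span_le]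
    have hX : ∀ i : Fin r, φ (if i = p ∨ i = j then 1 else X i) =
        if i = p ∨ i = j then 1 else 0 := by
      intro i
      split_ifs with h <;> simp [φ, h]
    rintro q (⟨i, k, hik, hadj, rfl⟩ | ⟨i, k, l, hik, hil, hkl, rfl⟩)
    · simp only [SetLike.mem_coe, Ideal.mem_comap, RingHom.mem_ker, map_mul, aeval_X,
        Finset.mem_insert, Finset.mem_singleton, hX]
      have := hpj.symm
      split_ifs <;> grind
    · simp only [SetLike.mem_coe, Ideal.mem_comap, RingHom.mem_ker, map_mul, aeval_X,
        Finset.mem_insert, Finset.mem_singleton, hX]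
      split_ifs <;> grind
  have h0 : φ (∏ i, (X i : MvPolynomial (Fin r) K) ^ a i) = 0 := hle hmem
  have h1 : φ (∏ i, (X i : MvPolynomial (Fin r) K) ^ a i) = 1 := by
    rw [map_prod]
    refine Finset.prod_eq_one fun i _ => ?_
    by_cases h : i = p ∨ i = j
    · simp [φ, h]
    · push Not at h
      simp [ha i h.1 h.2]
  exact one_ne_zero (h1.symm.trans h0)

/-- If `i ≠ p` is not adjacent to `p`, then `x_i` lies in `I_G[{p}]S`. -/
lemma X_mem_locSR_singleton (K : Type*) [Field K] {r : ℕ} (G : SimpleGraph (Fin r))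
    {p i : Fin r} (hi : i ≠ p) (hadj : ¬ G.Adj p i) :
    (X i : MvPolynomial (Fin r) K) ∈ locSR K G {p} := by
  have h : (X p * X i : MvPolynomial (Fin r) K) ∈ SRIdeal K G :=
    Ideal.subset_span (Or.inl ⟨p, i, hi.symm, hadj, rfl⟩)
  simpa [locSR, hi] using Ideal.mem_map_of_mem
    (aeval (fun i : Fin r => if i ∈ ({p} : Finset (Fin r)) then 1 else X i) :
      MvPolynomial (Fin r) K →ₐ[K] MvPolynomial (Fin r) K) h

/-- If `p`, `i`, `k` are pairwise distinct, then `x_i x_k` lies in `I_G[{p}]S`. -/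
lemma X_mul_X_mem_locSR_singleton (K : Type*) [Field K] {r : ℕ} (G : SimpleGraph (Fin r))
    {p i k : Fin r} (hi : i ≠ p) (hk : k ≠ p) (hik : i ≠ k) :
    (X i * X k : MvPolynomial (Fin r) K) ∈ locSR K G {p} := by
  have h : (X p * X i * X k : MvPolynomial (Fin r) K) ∈ SRIdeal K G :=
    Ideal.subset_span (Or.inr ⟨p, i, k, hi.symm, hk.symm, hik, rfl⟩)
  simpa [locSR, hi, hk] using Ideal.mem_map_of_mem
    (aeval (fun i : Fin r => if i ∈ ({p} : Finset (Fin r)) then 1 else X i) :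
      MvPolynomial (Fin r) K →ₐ[K] MvPolynomial (Fin r) K) h

theorem stmt_12 (K : Type*) [Field K] {r : ℕ} (G : SimpleGraph (Fin r))
    (hiso : ∀ v : Fin r, ∃ w : Fin r, G.Adj v w)
    (a : Fin r → ℕ) (p : Fin r) :
    ¬ ((∏ i, (X i : MvPolynomial (Fin r) K) ^ a i) ∉ locSR K G {p} ∧
      ∀ j : Fin r, j ≠ p →
        (∏ i, (X i : MvPolynomial (Fin r) K) ^ a i) ∈ locSR K G {p, j}) := by
  rintro ⟨hp, hall⟩
  have hdvd : ∀ i, a i ≠ 0 → (X i : MvPolynomial (Fin r) K) ∣ X i ^ a i :=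
    fun i hi => dvd_pow_self _ hi
  have hadj : ∀ i, i ≠ p → a i ≠ 0 → G.Adj p i := by
    intro i hi hai
    by_contra h
    exact hp (Ideal.mem_of_dvd _ ((hdvd i hai).trans
      (Finset.dvd_prod_of_mem _ (Finset.mem_univ i))) (X_mem_locSR_singleton K G hi h))
  have huniq : ∀ i k, i ≠ p → k ≠ p → a i ≠ 0 → a k ≠ 0 → i = k := by
    intro i k hi hk hai hak
    by_contra h
    refine hp (Ideal.mem_of_dvd _ ?_ (X_mul_X_mem_locSR_singleton K G hi hk h))
    refine (mul_dvd_mul (hdvd i hai) (hdvd k hak)).trans ?_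
    rw [← Finset.prod_pair (f := fun i => (X i : MvPolynomial (Fin r) K) ^ a i) h]
    exact Finset.prod_dvd_prod_of_subset _ _ _ (Finset.subset_univ _)
  obtain ⟨j, hj, hsupp⟩ : ∃ j, G.Adj p j ∧ ∀ i, i ≠ p → i ≠ j → a i = 0 := by
    by_cases h : ∃ i, i ≠ p ∧ a i ≠ 0
    · obtain ⟨j, hjp, haj⟩ := h
      refine ⟨j, hadj j hjp haj, fun i hi hij => ?_⟩
      by_contra hai
      exact hij (huniq i j hi hjp hai haj)
    · push Not at h
      obtain ⟨j, hj⟩ := hiso p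
      exact ⟨j, hj, fun i hi _ => h i hi⟩
  exact prod_X_pow_notMem_locSR_pair K G hj a hsupp (hall j hj.ne')
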